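/- Let Z = (α,β) ∈ aff(R) with Hamiltonian function Z̃(p,q) = αp + βe^q, and let ℓ_Z(v) := iZ̃ ⋆ v denote left Moyal multiplication by iZ̃. Then for every compactly supported smooth function u : R² → C (in the variables (x,q)), the series defining ℓ_Z(F_p⁻¹(u)) converges, and the conjugated operator ℓ̂_Z := F_p ∘ ℓ_Z ∘ F_p⁻¹ satisfies ℓ̂_Z(u)(x,q) = α((1/2)∂_q u − ∂_x u)(x,q) + iβ e^{q − x/2} u(x,q). -/

import Mathlib

noncomputable section

open Complex MeasureTheory

/-- The standard basis vectors of `ℝ²` in the coordinates `x = (x¹,x²) = (p,q)`. -/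
def basisR2 : Fin 2 → ℝ × ℝ := ![(1, 0), (0, 1)]

/-- The partial derivative of `f : ℝ² → ℂ` in the `i`-th coordinate direction. -/
def pd2 (i : Fin 2) (f : ℝ × ℝ → ℂ) : ℝ × ℝ → ℂ :=
  fun x => fderiv ℝ f x (basisR2 i)

/-- Iterated partial derivative `∂^r f / ∂x^{i₁}⋯∂x^{i_r}`. -/
def pd2Multi : (r : ℕ) → (Fin r → Fin 2) → (ℝ × ℝ → ℂ) → (ℝ × ℝ → ℂ)
  | 0, _, f => f
  | r + 1, idx, f => pd2Multi r (fun k => idx k.succ) (pd2 (idx 0) f)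

/-- The matrix `Λ` with `Λ¹² = 1`, `Λ²¹ = -1`, `Λ¹¹ = Λ²² = 0`. -/
def lambda2 : Fin 2 → Fin 2 → ℂ :=
  fun i j => !![0, 1; -1, 0] i j

/-- `P^r(u,v) = Σ Λ^{i₁j₁}⋯Λ^{i_rj_r} ∂_{i₁⋯i_r}u ∂_{j₁⋯j_r}v`. -/
def P2 (r : ℕ) (u v : ℝ × ℝ → ℂ) : ℝ × ℝ → ℂ := fun x =>
  ∑ i : Fin r → Fin 2, ∑ j : Fin r → Fin 2,
    (∏ k : Fin r, lambda2 (i k) (j k)) * pd2Multi r i u x * pd2Multi r j v x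

/-- The Moyal ⋆-product `u ⋆ v = uv + Σ_{r≥1} (1/r!)(1/(2i))^r P^r(u,v)`
(the `r = 0` term of the series is exactly `uv`). -/
def moyal2 (u v : ℝ × ℝ → ℂ) : ℝ × ℝ → ℂ := fun x =>
  ∑' r : ℕ, ((r.factorial : ℂ))⁻¹ * (1 / (2 * I)) ^ r * P2 r u v x

/-- The Hamiltonian function `Z̃(p,q) = αp + βe^q` of `Z = (α,β) ∈ aff(ℝ)`,
viewed as complex valued. -/
def affHam (Z : ℝ × ℝ) : ℝ × ℝ → ℂ := fun x =>
  (Z.1 : ℂ) * (x.1 : ℂ) + (Z.2 : ℂ) * (Real.exp x.2 : ℂ)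

/-- The partial Fourier transform in the variable `p`:
`F_p(u)(x,q) = (1/√(2π)) ∫ e^{-ipx} u(p,q) dp`. -/
def Fp (u : ℝ × ℝ → ℂ) : ℝ × ℝ → ℂ := fun v =>
  (1 / Real.sqrt (2 * Real.pi) : ℝ) •
    ∫ p : ℝ, Complex.exp (-(I * (p : ℂ) * (v.1 : ℂ))) * u (p, v.2)

/-- The inverse partial Fourier transform:
`F_p⁻¹(u)(p,q) = (1/√(2π)) ∫ e^{ipx} u(x,q) dx`. -/
def FpInv (u : ℝ × ℝ → ℂ) : ℝ × ℝ → ℂ := fun v =>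
  (1 / Real.sqrt (2 * Real.pi) : ℝ) •
    ∫ x : ℝ, Complex.exp (I * (v.1 : ℂ) * (x : ℂ)) * u (x, v.2)

/-! ### The bidifferential operators -/

lemma P2_zero (f g : ℝ × ℝ → ℂ) (x : ℝ × ℝ) : P2 0 f g x = f x * g x := by
  simp [P2, pd2Multi]

lemma P2_succ (r : ℕ) (f g : ℝ × ℝ → ℂ) (x : ℝ × ℝ) :
    P2 (r + 1) f g x = P2 r (pd2 0 f) (pd2 1 g) x - P2 r (pd2 1 f) (pd2 0 g) x := by
  have key : ∀ F : (Fin (r + 1) → Fin 2) → ℂ,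
      ∑ i, F i = ∑ a : Fin 2, ∑ i : Fin r → Fin 2, F (Fin.cons a i) := by
    intro F
    rw [← (Fin.consEquiv fun _ => Fin 2).sum_comp, Fintype.sum_prod_type]
    rfl
  unfold P2
  rw [key]
  simp_rw [key, Fin.prod_univ_succ, pd2Multi, Fin.cons_zero, Fin.cons_succ, Fin.sum_univ_two]
  simp [lambda2, Finset.sum_neg_distrib, sub_eq_add_neg]

lemma pd2_const (i : Fin 2) (c : ℂ) : pd2 i (fun _ => c) = fun _ => 0 := by
  funext x
  simp [pd2]

lemma P2_zero_left (r : ℕ) (g : ℝ × ℝ → ℂ) (x : ℝ × ℝ) : P2 r (fun _ => 0) g x = 0 := by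
  induction r generalizing g with
  | zero => simp [P2_zero]
  | succ r ih => simp [P2_succ, pd2_const, ih]

lemma P2_const_succ (r : ℕ) (c : ℂ) (g : ℝ × ℝ → ℂ) (x : ℝ × ℝ) :
    P2 (r + 1) (fun _ => c) g x = 0 := by
  simp [P2_succ, pd2_const, P2_zero_left]

lemma hasFDerivAt_const_mul_exp_snd (c : ℂ) (x : ℝ × ℝ) :
    HasFDerivAt (fun y : ℝ × ℝ => c * (Real.exp y.2 : ℂ))
      (c • ofRealCLM.comp (Real.exp x.2 • ContinuousLinearMap.snd ℝ ℝ ℝ)) x := by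
  have h : HasFDerivAt (fun y : ℝ × ℝ => Real.exp y.2)
      (Real.exp x.2 • ContinuousLinearMap.snd ℝ ℝ ℝ) x := hasFDerivAt_snd.exp
  exact (ofRealCLM.hasFDerivAt.comp x h).const_mul c

lemma pd2_zero_exp_snd (c : ℂ) :
    pd2 0 (fun y => c * (Real.exp y.2 : ℂ)) = fun _ => 0 := by
  funext x
  simp only [pd2, (hasFDerivAt_const_mul_exp_snd c x).fderiv]
  simp [basisR2]

lemma pd2_one_exp_snd (c : ℂ) :
    pd2 1 (fun y => c * (Real.exp y.2 : ℂ)) = fun y => c * (Real.exp y.2 : ℂ) := by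
  funext x
  simp only [pd2, (hasFDerivAt_const_mul_exp_snd c x).fderiv]
  simp [basisR2]

lemma hasFDerivAt_I_mul_affHam (Z x : ℝ × ℝ) :
    HasFDerivAt (fun y => I * affHam Z y)
      ((I * Z.1) • ofRealCLM.comp (ContinuousLinearMap.fst ℝ ℝ ℝ) +
        (I * Z.2) • ofRealCLM.comp (Real.exp x.2 • ContinuousLinearMap.snd ℝ ℝ ℝ)) x := by
  have h₁ : HasFDerivAt (fun y : ℝ × ℝ => I * Z.1 * (y.1 : ℂ))
      ((I * Z.1) • ofRealCLM.comp (ContinuousLinearMap.fst ℝ ℝ ℝ)) x :=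
    (ofRealCLM.comp (ContinuousLinearMap.fst ℝ ℝ ℝ)).hasFDerivAt.const_mul (I * (Z.1 : ℂ))
  refine (h₁.add (hasFDerivAt_const_mul_exp_snd (I * Z.2) x)).congr_of_eventuallyEq ?_
  filter_upwards with y
  simp only [affHam, Pi.add_apply]
  ring

lemma pd2_zero_I_mul_affHam (Z : ℝ × ℝ) :
    pd2 0 (fun y => I * affHam Z y) = fun _ => I * (Z.1 : ℂ) := by
  funext x
  simp only [pd2, (hasFDerivAt_I_mul_affHam Z x).fderiv]
  simp [basisR2]

lemma pd2_one_I_mul_affHam (Z : ℝ × ℝ) :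
    pd2 1 (fun y => I * affHam Z y) = fun y => I * (Z.2 : ℂ) * (Real.exp y.2 : ℂ) := by
  funext x
  simp only [pd2, (hasFDerivAt_I_mul_affHam Z x).fderiv]
  simp [basisR2]

/-! ### Differentiation under the integral sign -/

lemma fderiv_integral_of_compact_support {Φ : (ℝ × ℝ) × ℝ → ℂ} (hΦ : ContDiff ℝ 1 Φ)
    {K : Set ℝ} (hK : IsCompact K) (h0 : ∀ v, ∀ x ∉ K, Φ (v, x) = 0) (v e : ℝ × ℝ) :
    fderiv ℝ (fun v => ∫ x, Φ (v, x)) v e = ∫ x, fderiv ℝ Φ (v, x) (e, 0) := by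
  set F' : ℝ × ℝ → ℝ → (ℝ × ℝ →L[ℝ] ℂ) := fun v x =>
    (fderiv ℝ Φ (v, x)).comp (ContinuousLinearMap.inl ℝ (ℝ × ℝ) ℝ) with hF'
  have hd : ∀ v x, HasFDerivAt (fun v => Φ (v, x)) (F' v x) v := fun v x =>
    ((hΦ.differentiable one_ne_zero (v, x)).hasFDerivAt).comp v (hasFDerivAt_prodMk_left v x)
  have hF'0 : ∀ v, ∀ x ∉ K, F' v x = 0 := fun v x hx =>
    (hd v x).unique ((hasFDerivAt_const (0 : ℂ) v).congr_of_eventuallyEq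
      (Filter.Eventually.of_forall fun w => h0 w x hx))
  have hc : Continuous fun z : (ℝ × ℝ) × ℝ => F' z.1 z.2 :=
    (hΦ.continuous_fderiv one_ne_zero).clm_comp continuous_const
  have hcv : Continuous (F' v) := hc.comp (Continuous.prodMk_right v)
  obtain ⟨C, hC⟩ := ((isCompact_closedBall v 1).prod hK).exists_bound_of_continuousOn hc.continuousOn
  have hmain := hasFDerivAt_integral_of_dominated_of_fderiv_le (μ := volume) (𝕜 := ℝ)
    (F := fun v x => Φ (v, x)) (F' := F') (x₀ := v) (bound := K.indicator fun _ => C)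
    (Metric.closedBall_mem_nhds v one_pos)
    (Filter.Eventually.of_forall fun w =>
      (hΦ.continuous.comp (Continuous.prodMk_right w)).aestronglyMeasurable)
    ((hΦ.continuous.comp (Continuous.prodMk_right v)).integrable_of_hasCompactSupport
      (HasCompactSupport.intro hK fun x hx => h0 v x hx))
    hcv.aestronglyMeasurable
    (Filter.Eventually.of_forall fun x w hw => by
      by_cases hx : x ∈ K
      · simpa [hx] using hC (w, x) ⟨hw, hx⟩
      · simp [hx, hF'0 w x hx])
    ((integrable_indicator_iff hK.measurableSet).2
      (integrableOn_const hK.measure_lt_top.ne))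
    (Filter.Eventually.of_forall fun x w _ => hd w x)
  rw [hmain.fderiv, ContinuousLinearMap.integral_apply
    (hcv.integrable_of_hasCompactSupport (HasCompactSupport.intro hK (hF'0 v)))]
  simp [hF']

/-! ### The partial Fourier transform of test functions -/

section TestFunction

variable {u : ℝ × ℝ → ℂ}

lemma hasCompactSupport_slice (hs : HasCompactSupport u) (q : ℝ) :
    HasCompactSupport fun x => u (x, q) :=
  HasCompactSupport.intro (hs.isCompact.image continuous_fst) fun _ hx =>
    image_eq_zero_of_notMem_tsupport fun h => hx ⟨_, h, rfl⟩

lemma integrable_exp_mul_slice (hu : Continuous u) (hs : HasCompactSupport u) (p q : ℝ) :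
    Integrable fun x : ℝ => Complex.exp (I * (p : ℂ) * (x : ℂ)) * u (x, q) :=
  Continuous.integrable_of_hasCompactSupport (by fun_prop) (hasCompactSupport_slice hs q).mul_left

lemma FpInv_add {w : ℝ × ℝ → ℂ} (hu : Continuous u) (hs : HasCompactSupport u)
    (hw : Continuous w) (hsw : HasCompactSupport w) (v : ℝ × ℝ) :
    FpInv (fun y => u y + w y) v = FpInv u v + FpInv w v := by
  simp only [FpInv, mul_add]
  rw [integral_add (integrable_exp_mul_slice hu hs _ _) (integrable_exp_mul_slice hw hsw _ _),
    smul_add]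

lemma FpInv_snd_mul (c : ℝ → ℂ) (v : ℝ × ℝ) :
    FpInv (fun y => c y.2 * u y) v = c v.2 * FpInv u v := by
  simp only [FpInv, mul_left_comm _ (c v.2), integral_const_mul, mul_smul_comm]

lemma FpInv_const_mul (c : ℂ) (v : ℝ × ℝ) : FpInv (fun y => c * u y) v = c * FpInv u v :=
  FpInv_snd_mul (fun _ => c) v

lemma contDiff_pd2 (hu : ContDiff ℝ (⊤ : ℕ∞) u) (i : Fin 2) :
    ContDiff ℝ (⊤ : ℕ∞) (pd2 i u) :=
  (hu.fderiv_right (m := (⊤ : ℕ∞)) (by simp)).clm_apply contDiff_const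

lemma hasCompactSupport_pd2 (hs : HasCompactSupport u) (i : Fin 2) :
    HasCompactSupport (pd2 i u) :=
  hs.fderiv_apply ℝ _

lemma hasFDerivAt_fourier_kernel_mul (hu : Differentiable ℝ u) (z : (ℝ × ℝ) × ℝ) :
    HasFDerivAt (fun z : (ℝ × ℝ) × ℝ =>
        Complex.exp (I * (z.1.1 : ℂ) * (z.2 : ℂ)) * u (z.2, z.1.2))
      (Complex.exp (I * (z.1.1 : ℂ) * (z.2 : ℂ)) •
          (fderiv ℝ u (z.2, z.1.2)).comp ((ContinuousLinearMap.snd ℝ (ℝ × ℝ) ℝ).prod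
            ((ContinuousLinearMap.snd ℝ ℝ ℝ).comp (ContinuousLinearMap.fst ℝ (ℝ × ℝ) ℝ))) +
        u (z.2, z.1.2) • (Complex.exp (I * (z.1.1 : ℂ) * (z.2 : ℂ)) •
          ((I * (z.1.1 : ℂ)) • ofRealCLM.comp (ContinuousLinearMap.snd ℝ (ℝ × ℝ) ℝ) +
            (z.2 : ℂ) • I • ofRealCLM.comp
              ((ContinuousLinearMap.fst ℝ ℝ ℝ).comp (ContinuousLinearMap.fst ℝ (ℝ × ℝ) ℝ))))) z := by
  have h₁ : HasFDerivAt (fun z : (ℝ × ℝ) × ℝ => I * (z.1.1 : ℂ))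
      (I • ofRealCLM.comp
        ((ContinuousLinearMap.fst ℝ ℝ ℝ).comp (ContinuousLinearMap.fst ℝ (ℝ × ℝ) ℝ))) z :=
    (ofRealCLM.comp ((ContinuousLinearMap.fst ℝ ℝ ℝ).comp
      (ContinuousLinearMap.fst ℝ (ℝ × ℝ) ℝ))).hasFDerivAt.const_mul I
  have h₂ : HasFDerivAt (fun z : (ℝ × ℝ) × ℝ => (z.2 : ℂ))
      (ofRealCLM.comp (ContinuousLinearMap.snd ℝ (ℝ × ℝ) ℝ)) z :=
    (ofRealCLM.comp (ContinuousLinearMap.snd ℝ (ℝ × ℝ) ℝ)).hasFDerivAt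
  have h₃ : HasFDerivAt (fun z : (ℝ × ℝ) × ℝ => (z.2, z.1.2))
      ((ContinuousLinearMap.snd ℝ (ℝ × ℝ) ℝ).prod
        ((ContinuousLinearMap.snd ℝ ℝ ℝ).comp (ContinuousLinearMap.fst ℝ (ℝ × ℝ) ℝ))) z :=
    ((ContinuousLinearMap.snd ℝ (ℝ × ℝ) ℝ).prod
      ((ContinuousLinearMap.snd ℝ ℝ ℝ).comp (ContinuousLinearMap.fst ℝ (ℝ × ℝ) ℝ))).hasFDerivAt
  exact (h₁.mul h₂).cexp.mul ((hu (z.2, z.1.2)).hasFDerivAt.comp z h₃)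

lemma fderiv_FpInv (hu : ContDiff ℝ (⊤ : ℕ∞) u) (hs : HasCompactSupport u) (v e : ℝ × ℝ) :
    fderiv ℝ (FpInv u) v e = (1 / Real.sqrt (2 * Real.pi) : ℝ) •
      ∫ x : ℝ, Complex.exp (I * (v.1 : ℂ) * (x : ℂ)) *
        (fderiv ℝ u (x, v.2) (0, e.2) + I * x * e.1 * u (x, v.2)) := by
  set Φ : (ℝ × ℝ) × ℝ → ℂ := fun z =>
    Complex.exp (I * (z.1.1 : ℂ) * (z.2 : ℂ)) * u (z.2, z.1.2) with hΦdef
  have h₁ : ContDiff ℝ (⊤ : ℕ∞) fun z : (ℝ × ℝ) × ℝ => (z.1.1 : ℂ) :=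
    ofRealCLM.contDiff.comp (contDiff_fst.comp contDiff_fst)
  have h₂ : ContDiff ℝ (⊤ : ℕ∞) fun z : (ℝ × ℝ) × ℝ => (z.2 : ℂ) :=
    ofRealCLM.contDiff.comp contDiff_snd
  have hΦ : ContDiff ℝ (⊤ : ℕ∞) Φ :=
    (((contDiff_const.mul h₁).mul h₂).cexp).mul
      (hu.comp (contDiff_snd.prodMk (contDiff_snd.comp contDiff_fst)))
  have key := fderiv_integral_of_compact_support (hΦ.of_le (by exact_mod_cast le_top))
    (hs.isCompact.image continuous_fst)
    (fun v x hx => by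
      have : u (x, v.2) = 0 := image_eq_zero_of_notMem_tsupport fun h => hx ⟨_, h, rfl⟩
      simp [hΦdef, this]) v e
  have hFp : FpInv u = fun v => (1 / Real.sqrt (2 * Real.pi) : ℝ) • ∫ x, Φ (v, x) := rfl
  rw [hFp]
  change fderiv ℝ ((1 / Real.sqrt (2 * Real.pi) : ℝ) • fun v => ∫ x, Φ (v, x)) v e = _
  rw [fderiv_const_smul_field, Pi.smul_apply, smul_apply, key]
  congr 2
  funext x
  rw [(hasFDerivAt_fourier_kernel_mul (hu.differentiable (by simp)) (v, x)).fderiv]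
  simp
  ring

lemma pd2_zero_FpInv (hu : ContDiff ℝ (⊤ : ℕ∞) u) (hs : HasCompactSupport u) :
    pd2 0 (FpInv u) = FpInv fun y => I * (y.1 : ℂ) * u y := by
  funext v
  have h : ∀ x : ℝ, fderiv ℝ u (x, v.2) (0, 0) = 0 := fun x => map_zero _
  simp only [pd2, fderiv_FpInv hu hs, FpInv]
  simp [basisR2, h]

lemma pd2_one_FpInv (hu : ContDiff ℝ (⊤ : ℕ∞) u) (hs : HasCompactSupport u) :
    pd2 1 (FpInv u) = FpInv (pd2 1 u) := by
  funext v
  simp only [pd2, fderiv_FpInv hu hs, FpInv]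
  simp [basisR2]

lemma contDiff_I_mul_fst_mul (hu : ContDiff ℝ (⊤ : ℕ∞) u) :
    ContDiff ℝ (⊤ : ℕ∞) fun y : ℝ × ℝ => I * (y.1 : ℂ) * u y :=
  (contDiff_const.mul (ofRealCLM.contDiff.comp contDiff_fst)).mul hu

lemma P2_exp_FpInv (r : ℕ) (c : ℂ) (hu : ContDiff ℝ (⊤ : ℕ∞) u) (hs : HasCompactSupport u)
    (v : ℝ × ℝ) :
    P2 r (fun y => c * (Real.exp y.2 : ℂ)) (FpInv u) v =
      c * (Real.exp v.2 : ℂ) * FpInv (fun y => (-(I * (y.1 : ℂ))) ^ r * u y) v := by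
  induction r generalizing u with
  | zero => simp [P2_zero]
  | succ r ih =>
    rw [P2_succ, pd2_zero_exp_snd, pd2_one_exp_snd, P2_zero_left, pd2_zero_FpInv hu hs,
      ih (contDiff_I_mul_fst_mul hu) hs.mul_left, zero_sub, ← mul_neg, ← neg_one_mul (FpInv _ v),
      ← FpInv_const_mul]
    congr 2
    funext y
    ring

lemma hasSum_FpInv_exp (hu : Continuous u) (hs : HasCompactSupport u) (v : ℝ × ℝ) :
    HasSum (fun r : ℕ => ((r.factorial : ℂ))⁻¹ * (1 / (2 * I)) ^ r *
        FpInv (fun y => (-(I * (y.1 : ℂ))) ^ r * u y) v)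
      (FpInv (fun y => Complex.exp (-(y.1 : ℂ) / 2) * u y) v) := by
  have hbd : ∀ x : ℝ, HasSum (fun r : ℕ => (|x| / 2) ^ r / r.factorial * ‖u (x, v.2)‖)
      (Real.exp (|x| / 2) * ‖u (x, v.2)‖) := fun x => by
    rw [Real.exp_eq_exp_ℝ]
    exact (NormedSpace.expSeries_div_hasSum_exp (|x| / 2)).mul_right _
  have key := hasSum_integral_of_dominated_convergence (μ := volume)
    (F := fun (r : ℕ) (x : ℝ) => Complex.exp (I * (v.1 : ℂ) * (x : ℂ)) *
      ((-(x : ℂ) / 2) ^ r / r.factorial * u (x, v.2)))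
    (f := fun x : ℝ => Complex.exp (I * (v.1 : ℂ) * (x : ℂ)) *
      (Complex.exp (-(x : ℂ) / 2) * u (x, v.2)))
    (fun r x => (|x| / 2) ^ r / r.factorial * ‖u (x, v.2)‖)
    (fun r => Continuous.aestronglyMeasurable (by fun_prop))
    (fun r => Filter.Eventually.of_forall fun x => by
      have : I * (v.1 : ℂ) * (x : ℂ) = ((v.1 * x : ℝ) : ℂ) * I := by push_cast; ring
      rw [norm_mul, this, norm_exp_ofReal_mul_I]
      simp)
    (Filter.Eventually.of_forall fun x => (hbd x).summable)
    (by
      simp_rw [(hbd _).tsum_eq]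
      exact Continuous.integrable_of_hasCompactSupport (by fun_prop)
        (hasCompactSupport_slice hs v.2).norm.mul_left)
    (Filter.Eventually.of_forall fun x => by
      rw [Complex.exp_eq_exp_ℂ]
      exact ((NormedSpace.expSeries_div_hasSum_exp (-(x : ℂ) / 2)).mul_right _).mul_left _)
  simp only [FpInv, real_smul]
  refine (key.mul_left _).congr_fun fun r => ?_
  rw [mul_left_comm, ← integral_const_mul]
  congr 2
  funext x
  have h : (-(x : ℂ) / 2) ^ r = (1 / (2 * I)) ^ r * (-(I * (x : ℂ))) ^ r := by
    rw [← mul_pow]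
    congr 1
    field_simp
  rw [h]
  ring

/-- Integration by parts: multiplication by `p` corresponds to `I ∂_x`. -/
lemma FpInv_pd2_zero (hu : ContDiff ℝ (⊤ : ℕ∞) u) (hs : HasCompactSupport u) (v : ℝ × ℝ) :
    FpInv (pd2 0 u) v = -(I * (v.1 : ℂ) * FpInv u v) := by
  have hd : ∀ x : ℝ, HasDerivAt (fun x => u (x, v.2)) (pd2 0 u (x, v.2)) x := fun x => by
    have h := (hu.differentiable (by simp) (x, v.2)).hasFDerivAt.comp_hasDerivAt x
      ((hasDerivAt_id x).prodMk (hasDerivAt_const x v.2))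
    exact h
  have he : ∀ x : ℝ, HasDerivAt (fun x : ℝ => Complex.exp (I * (v.1 : ℂ) * (x : ℂ)))
      (Complex.exp (I * (v.1 : ℂ) * (x : ℂ)) * (I * (v.1 : ℂ))) x := fun x => by
    simpa using ((ofRealCLM.hasDerivAt (x := x)).const_mul (I * (v.1 : ℂ))).cexp
  have hi := integrable_exp_mul_slice hu.continuous hs v.1 v.2
  have key := integral_mul_deriv_eq_deriv_mul_of_integrable (fun x _ => he x) (fun x _ => hd x)
    (integrable_exp_mul_slice (contDiff_pd2 hu 0).continuous (hasCompactSupport_pd2 hs 0) v.1 v.2)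
    ((hi.const_mul (I * (v.1 : ℂ))).congr (Filter.Eventually.of_forall fun x => by
      simp only [Pi.mul_apply]; ring)) hi
  simp only [FpInv]
  rw [key, mul_smul_comm, ← integral_const_mul, ← smul_neg]
  congr 3
  funext x
  ring

/-- Fourier inversion in the first variable. -/
lemma Fp_FpInv (hu : ContDiff ℝ (⊤ : ℕ∞) u) (hs : HasCompactSupport u) (v : ℝ × ℝ) :
    Fp (FpInv u) v = u v := by
  have hslice : ContDiff ℝ (⊤ : ℕ∞) fun x => u (x, v.2) :=
    hu.comp (contDiff_id.prodMk contDiff_const)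
  set f : SchwartzMap ℝ ℂ := (hasCompactSupport_slice hs v.2).toSchwartzMap hslice with hf
  have hfu : ∀ x, f x = u (x, v.2) := fun x => rfl
  have hinv : ∀ p : ℝ, ∫ x : ℝ, Complex.exp (I * (p : ℂ) * (x : ℂ)) * u (x, v.2) =
      FourierTransformInv.fourierInv (f : ℝ → ℂ) (p / (2 * Real.pi)) := fun p => by
    rw [Real.fourierInv_eq']
    congr 1
    funext x
    rw [hfu, smul_eq_mul]
    congr 2
    have : (Real.pi : ℂ) ≠ 0 := by exact_mod_cast Real.pi_ne_zero
    simp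
    field_simp
  have key : FourierTransform.fourier (FourierTransformInv.fourierInv (f : ℝ → ℂ)) v.1 = f v.1 := by
    rw [← SchwartzMap.fourierInv_coe, ← SchwartzMap.fourier_coe,
      FourierTransform.fourier_fourierInv_eq]
  have hscale := Measure.integral_comp_div (fun t : ℝ =>
    Complex.exp (↑(-2 * Real.pi * t * v.1) * I) *
      FourierTransformInv.fourierInv (f : ℝ → ℂ) t) (2 * Real.pi)
  have hpi : 0 < 2 * Real.pi := by positivity
  rw [Real.fourier_real_eq_integral_exp_smul] at key
  simp only [smul_eq_mul] at key
  rw [key, abs_of_pos hpi] at hscale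
  simp only [Fp, FpInv, hinv, mul_smul_comm, integral_smul, smul_smul]
  have hint : ∫ p : ℝ, Complex.exp (-(I * (p : ℂ) * (v.1 : ℂ))) *
      FourierTransformInv.fourierInv (f : ℝ → ℂ) (p / (2 * Real.pi)) = (2 * Real.pi) • f v.1 := by
    rw [← hscale]
    congr 1
    funext p
    congr 2
    have : (Real.pi : ℂ) ≠ 0 := by exact_mod_cast Real.pi_ne_zero
    push_cast
    field_simp
  rw [hint, smul_smul, hfu, div_mul_div_comm, Real.mul_self_sqrt hpi.le, one_mul,
    one_div_mul_cancel hpi.ne', one_smul]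

end TestFunction

lemma P2_I_mul_affHam_succ (Z : ℝ × ℝ) (r : ℕ) (g : ℝ × ℝ → ℂ) (x : ℝ × ℝ) :
    P2 (r + 1) (fun y => I * affHam Z y) g x =
      P2 r (fun _ => I * (Z.1 : ℂ)) (pd2 1 g) x +
        P2 (r + 1) (fun y => I * (Z.2 : ℂ) * (Real.exp y.2 : ℂ)) g x := by
  rw [P2_succ, P2_succ, pd2_zero_I_mul_affHam, pd2_one_I_mul_affHam, pd2_zero_exp_snd,
    pd2_one_exp_snd, P2_zero_left]
  ring

lemma hasSum_moyal_affHam_FpInv (Z : ℝ × ℝ) {u : ℝ × ℝ → ℂ} (hu : ContDiff ℝ (⊤ : ℕ∞) u)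
    (hs : HasCompactSupport u) (v : ℝ × ℝ) :
    HasSum (fun r : ℕ => ((r.factorial : ℂ))⁻¹ * (1 / (2 * I)) ^ r *
        P2 r (fun y => I * affHam Z y) (FpInv u) v)
      (FpInv (fun y => (Z.1 : ℂ) * ((1 / 2) * pd2 1 u y - pd2 0 u y) +
        I * (Z.2 : ℂ) * Complex.exp ((y.2 : ℂ) - (y.1 : ℂ) / 2) * u y) v) := by
  have hexp := (hasSum_FpInv_exp hu.continuous hs v).mul_left (I * (Z.2 : ℂ) * (Real.exp v.2 : ℂ))
  have hpoly := hasSum_sum_of_ne_finset_zero (L := .unconditional ℕ) (s := Finset.range 2)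
    (f := fun r : ℕ => ((r.factorial : ℂ))⁻¹ * (1 / (2 * I)) ^ r *
      (P2 r (fun y => I * affHam Z y) (FpInv u) v -
        P2 r (fun y => I * (Z.2 : ℂ) * (Real.exp y.2 : ℂ)) (FpInv u) v))
    (fun r hr => by
      obtain ⟨k, rfl⟩ : ∃ k, r = k + 2 := ⟨r - 2, by simp at hr; omega⟩
      rw [P2_I_mul_affHam_succ, P2_const_succ]
      simp)
  convert hpoly.add hexp using 1
  · funext r
    rw [P2_exp_FpInv r _ hu hs]
    ring
  · have hsplit : (fun y : ℝ × ℝ => (Z.1 : ℂ) * ((1 / 2) * pd2 1 u y - pd2 0 u y) +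
        I * (Z.2 : ℂ) * Complex.exp ((y.2 : ℂ) - (y.1 : ℂ) / 2) * u y) =
        fun y => ((Z.1 : ℂ) / 2 * pd2 1 u y + -(Z.1 : ℂ) * pd2 0 u y) +
          I * (Z.2 : ℂ) * (Real.exp y.2 : ℂ) * (Complex.exp (-(y.1 : ℂ) / 2) * u y) := by
      funext y
      rw [sub_eq_add_neg (y.2 : ℂ), Complex.exp_add, ofReal_exp, neg_div]
      ring
    have h₀ := (contDiff_pd2 hu 0).continuous
    have h₁ := (contDiff_pd2 hu 1).continuous
    have hc := hu.continuous
    have s₀ : HasCompactSupport fun y => -(Z.1 : ℂ) * pd2 0 u y :=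
      (hasCompactSupport_pd2 hs 0).mul_left
    have s₁ : HasCompactSupport fun y => (Z.1 : ℂ) / 2 * pd2 1 u y :=
      (hasCompactSupport_pd2 hs 1).mul_left
    have s₂ : HasCompactSupport fun y : ℝ × ℝ =>
        (Z.1 : ℂ) / 2 * pd2 1 u y + -(Z.1 : ℂ) * pd2 0 u y :=
      s₁.add s₀
    have s₃ : HasCompactSupport fun y : ℝ × ℝ =>
        I * (Z.2 : ℂ) * (Real.exp y.2 : ℂ) * (Complex.exp (-(y.1 : ℂ) / 2) * u y) :=
      hs.mul_left.mul_left
    rw [hsplit, FpInv_add (by fun_prop) s₂ (by fun_prop) s₃,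
      FpInv_add (by fun_prop) s₁ (by fun_prop) s₀, FpInv_const_mul, FpInv_const_mul,
      FpInv_snd_mul (fun q => I * (Z.2 : ℂ) * (Real.exp q : ℂ)), FpInv_pd2_zero hu hs,
      Finset.sum_range_succ, Finset.sum_range_one, P2_I_mul_affHam_succ]
    simp only [P2_zero, pd2_one_FpInv hu hs, affHam]
    simp
    linear_combination (Z.1 * FpInv (pd2 1 u) v / 2) * I_sq

/-- For `Z = (α,β) ∈ aff(ℝ)` and `ℓ_Z(v) = iZ̃ ⋆ v` the left Moyal multiplication
by `iZ̃`: for every compactly supported smooth `u : ℝ² → ℂ` (in the variables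
`(x,q)`), the Moyal series defining `ℓ_Z(F_p⁻¹(u))` converges, and
`ℓ̂_Z := F_p ∘ ℓ_Z ∘ F_p⁻¹` satisfies
`ℓ̂_Z(u)(x,q) = α((1/2)∂_q u - ∂_x u)(x,q) + iβe^{q - x/2}u(x,q)`. -/
theorem lhat_affR (Z : ℝ × ℝ) (u : ℝ × ℝ → ℂ)
    (hsmooth : ContDiff ℝ (⊤ : ℕ∞) u) (hsupp : HasCompactSupport u) :
    (∀ x : ℝ × ℝ,
      Summable (fun r : ℕ => ((r.factorial : ℂ))⁻¹ * (1 / (2 * I)) ^ r *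
        P2 r (fun y => I * affHam Z y) (FpInv u) x)) ∧
    (∀ v : ℝ × ℝ,
      Fp (moyal2 (fun y => I * affHam Z y) (FpInv u)) v =
        (Z.1 : ℂ) * ((1 / 2) * pd2 1 u v - pd2 0 u v) +
          I * (Z.2 : ℂ) * Complex.exp ((v.2 : ℂ) - (v.1 : ℂ) / 2) * u v) := by
  have hsum := hasSum_moyal_affHam_FpInv Z hsmooth hsupp
  refine ⟨fun x => (hsum x).summable, fun v => ?_⟩
  have hmoyal : moyal2 (fun y => I * affHam Z y) (FpInv u) = FpInv _ :=
    funext fun x => (hsum x).tsum_eq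
  have h₁ : ContDiff ℝ (⊤ : ℕ∞) fun y : ℝ × ℝ => (y.1 : ℂ) := ofRealCLM.contDiff.comp contDiff_fst
  have h₂ : ContDiff ℝ (⊤ : ℕ∞) fun y : ℝ × ℝ => (y.2 : ℂ) := ofRealCLM.contDiff.comp contDiff_snd
  rw [hmoyal, Fp_FpInv]
  · exact (contDiff_const.mul ((contDiff_const.mul (contDiff_pd2 hsmooth 1)).sub
      (contDiff_pd2 hsmooth 0))).add
        ((contDiff_const.mul (h₂.sub (h₁.div_const 2)).cexp).mul hsmooth)
  · exact (((hasCompactSupport_pd2 hsupp 1).mul_left.sub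
      (hasCompactSupport_pd2 hsupp 0)).mul_left).add hsupp.mul_left

end
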